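/- (Corollary 1, ZeroSARAH with one initial full gradient.) Suppose n ≥ 2 is a perfect square and f is bounded below with f* := inf_x f(x). Run ZeroSARAH with constant stepsize η_k = η := 1/((1+√8)L), minibatch sizes b_0 = n and b_k = √n for k ≥ 1, and parameters λ_0 = 1, λ_k = 1/(2√n) for k ≥ 1. Then for every K ≥ 1, (1/K) ∑_{k=0}^{K−1} E[‖∇f(x^k)‖²] ≤ 2(1+√8)L(f(x⁰) − f*)/K. Consequently, for every ε > 0, taking K = ⌈2(1+√8)L(f(x⁰) − f*)/ε²⌉ yields (1/K)∑_{k=0}^{K−1}E[‖∇f(x^k)‖²] ≤ ε² while the total number of stochastic gradient computations ∑_{k=0}^{K−1} b_k = n + (K−1)√n is at most n + 2(1+√8)√n L(f(x⁰) − f*)/ε² + √n. -/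

import Mathlib

noncomputable section

/-- The average function `f = (1/n) ∑ᵢ fᵢ`. -/
noncomputable def avgF {d n : ℕ} (f : Fin n → EuclideanSpace ℝ (Fin d) → ℝ) :
    EuclideanSpace ℝ (Fin d) → ℝ :=
  fun z => (n : ℝ)⁻¹ * ∑ i, f i z

/-- The ZeroSARAH random process.  Given a draw `ω : ℕ → Finset (Fin n)` of minibatches,
`zsState f η lam b x0 ω k = (xᵏ, xᵏ⁻¹, vᵏ⁻¹, y^{k−1})`, with
`x⁻¹ = x⁰`, `v⁻¹ = 0`, `y⁻¹ = 0`, and at each step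
`vᵏ = (1/bₖ)∑_{i∈Iₖ}(∇fᵢ(xᵏ) − ∇fᵢ(xᵏ⁻¹)) + (1−λₖ)vᵏ⁻¹
     + λₖ[(1/bₖ)∑_{i∈Iₖ}(∇fᵢ(xᵏ⁻¹) − yᵢᵏ⁻¹) + (1/n)∑ⱼ yⱼᵏ⁻¹]`,
`xᵏ⁺¹ = xᵏ − ηₖ vᵏ`, `yᵢᵏ = ∇fᵢ(xᵏ)` for `i ∈ Iₖ`, `yᵢᵏ = yᵢᵏ⁻¹` otherwise. -/
noncomputable def zsState {d n : ℕ} (f : Fin n → EuclideanSpace ℝ (Fin d) → ℝ)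
    (η lam : ℕ → ℝ) (b : ℕ → ℕ) (x0 : EuclideanSpace ℝ (Fin d))
    (ω : ℕ → Finset (Fin n)) :
    ℕ → EuclideanSpace ℝ (Fin d) × EuclideanSpace ℝ (Fin d) ×
      EuclideanSpace ℝ (Fin d) × (Fin n → EuclideanSpace ℝ (Fin d))
  | 0 => (x0, x0, 0, fun _ => 0)
  | (k + 1) =>
      let st := zsState f η lam b x0 ω k
      let v : EuclideanSpace ℝ (Fin d) :=
        (b k : ℝ)⁻¹ • ∑ i ∈ ω k, (gradient (f i) st.1 - gradient (f i) st.2.1)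
          + (1 - lam k) • st.2.2.1
          + lam k • ((b k : ℝ)⁻¹ • ∑ i ∈ ω k, (gradient (f i) st.2.1 - st.2.2.2 i)
              + (n : ℝ)⁻¹ • ∑ j, st.2.2.2 j)
      (st.1 - η k • v, st.1, v,
        fun i => if i ∈ ω k then gradient (f i) st.1 else st.2.2.2 i)

/-- Expectation over the first `k` independent uniformly random minibatches
`I₀, …, I_{k−1}` with `|Iⱼ| = bⱼ`, of a functional of the whole draw. -/
noncomputable def zsExpK {n : ℕ} (b : ℕ → ℕ) (k : ℕ)
    (g : (ℕ → Finset (Fin n)) → ℝ) : ℝ :=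
  (∑ τ ∈ Finset.univ.filter
      (fun τ : Fin k → Finset (Fin n) => ∀ j : Fin k, (τ j).card = b j.val),
    g (fun j => if h : j < k then τ ⟨j, h⟩ else ∅)) /
  ((Finset.univ.filter
      (fun τ : Fin k → Finset (Fin n) => ∀ j : Fin k, (τ j).card = b j.val)).card : ℝ)

/-- Average over uniformly random subsets of size `b`. -/
def zsB {n : ℕ} (b : ℕ) (h : Finset (Fin n) → ℝ) : ℝ :=
  (∑ I ∈ Finset.powersetCard b (Finset.univ : Finset (Fin n)), h I) /
    ((Finset.powersetCard b (Finset.univ : Finset (Fin n))).card : ℝ)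

lemma zsB_pos {n b : ℕ} (hbn : b ≤ n) :
    (0 : ℝ) < ((Finset.powersetCard b (Finset.univ : Finset (Fin n))).card : ℝ) := by
  simp only [Finset.card_powersetCard, Finset.card_univ, Fintype.card_fin]
  exact_mod_cast Nat.choose_pos hbn

lemma zsB_mono {n b : ℕ} {h h' : Finset (Fin n) → ℝ}
    (H : ∀ I : Finset (Fin n), I.card = b → h I ≤ h' I) : zsB b h ≤ zsB b h' := by
  unfold zsB
  gcongr with I hI
  exact H I (Finset.mem_powersetCard.1 hI).2

lemma zsB_congr {n b : ℕ} {h h' : Finset (Fin n) → ℝ}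
    (H : ∀ I : Finset (Fin n), I.card = b → h I = h' I) : zsB b h = zsB b h' :=
  le_antisymm (zsB_mono fun I hI => (H I hI).le) (zsB_mono fun I hI => (H I hI).ge)

lemma zsB_add {n b : ℕ} (h h' : Finset (Fin n) → ℝ) :
    zsB b (fun I => h I + h' I) = zsB b h + zsB b h' := by
  unfold zsB
  rw [Finset.sum_add_distrib, add_div]

lemma zsB_mul {n b : ℕ} (c : ℝ) (h : Finset (Fin n) → ℝ) :
    zsB b (fun I => c * h I) = c * zsB b h := by
  unfold zsB
  rw [← Finset.mul_sum, mul_div_assoc]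

lemma zsB_const {n b : ℕ} (hbn : b ≤ n) (c : ℝ) :
    zsB b (fun _ : Finset (Fin n) => c) = c := by
  unfold zsB
  have := zsB_pos hbn
  rw [Finset.sum_const, nsmul_eq_mul]
  field_simp

lemma zsB_card_mem {n b : ℕ} (hb : 1 ≤ b) (hbn : b ≤ n) (i : Fin n) :
    (n : ℝ) * ((Finset.powersetCard b (Finset.univ : Finset (Fin n))).filter
      (fun I => i ∈ I)).card = b * (Finset.powersetCard b (Finset.univ : Finset (Fin n))).card := by
  have h := Finset.card_filter_powersetCard_subset {i} (Finset.univ : Finset (Fin n)) b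
    (Finset.subset_univ _) (by simpa using hb)
  simp only [Finset.singleton_subset_iff, Finset.card_univ, Fintype.card_fin,
    Finset.card_singleton] at h
  rw [h]
  simp only [Finset.card_powersetCard, Finset.card_univ, Fintype.card_fin]
  obtain ⟨m, rfl⟩ : ∃ m, n = m + 1 := ⟨n - 1, by omega⟩
  obtain ⟨c, rfl⟩ : ∃ c, b = c + 1 := ⟨b - 1, by omega⟩
  have := Nat.add_one_mul_choose_eq m c
  simp only [Nat.add_sub_cancel]
  rw [mul_comm ((c + 1 : ℕ) : ℝ)]
  exact_mod_cast this

lemma zsB_sum_mem {n b : ℕ} (hb : 1 ≤ b) (hbn : b ≤ n) (a : Fin n → ℝ) :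
    zsB b (fun I => ∑ i ∈ I, a i) = (b / n : ℝ) * ∑ i, a i := by
  have hn : (0 : ℝ) < n := by exact_mod_cast (by omega : 0 < n)
  have hC := zsB_pos hbn
  unfold zsB
  rw [div_eq_iff hC.ne']
  have : ∀ I : Finset (Fin n), ∑ i ∈ I, a i = ∑ i, if i ∈ I then a i else 0 := by
    intro I; simp
  simp_rw [this]
  rw [Finset.sum_comm, Finset.mul_sum, Finset.sum_mul]
  refine Finset.sum_congr rfl fun i _ => ?_
  rw [← Finset.sum_filter, Finset.sum_const, nsmul_eq_mul]
  have := zsB_card_mem hb hbn i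
  simp only [Finset.mem_univ, if_true]
  field_simp
  linear_combination a i * this

lemma zsB_pair {n b : ℕ} : ∃ p : ℝ, 0 ≤ p ∧ ∀ i j : Fin n, i ≠ j →
    (((Finset.powersetCard b (Finset.univ : Finset (Fin n))).filter
      (fun I => i ∈ I ∧ j ∈ I)).card : ℝ) = p := by
  by_cases hb : 2 ≤ b
  · refine ⟨((n - 2).choose (b - 2) : ℕ), by positivity, fun i j hij => ?_⟩
    have h := Finset.card_filter_powersetCard_subset {i, j} (Finset.univ : Finset (Fin n)) b
      (Finset.subset_univ _) (by rw [Finset.card_pair hij]; exact hb)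
    simp only [Finset.insert_subset_iff, Finset.singleton_subset_iff, Finset.card_univ,
      Fintype.card_fin, Finset.card_pair hij] at h
    rw [h]
  · refine ⟨0, le_rfl, fun i j hij => ?_⟩
    norm_cast
    rw [Finset.card_eq_zero, Finset.filter_eq_empty_iff]
    rintro I hI ⟨hi, hj⟩
    have h1 : ({i, j} : Finset (Fin n)) ⊆ I := by
      simp [Finset.insert_subset_iff, hi, hj]
    have h2 := Finset.card_le_card h1
    rw [Finset.card_pair hij, (Finset.mem_powersetCard.1 hI).2] at h2
    exact hb h2

lemma zsB_var {E : Type*} [NormedAddCommGroup E] [InnerProductSpace ℝ E] {n b : ℕ}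
    (hb : 1 ≤ b) (hbn : b ≤ n) (u : Fin n → E) (hu : ∑ i, u i = 0) :
    zsB b (fun I => ‖∑ i ∈ I, u i‖ ^ 2) ≤ (b / n : ℝ) * ∑ i, ‖u i‖ ^ 2 := by
  have hn : (0 : ℝ) < n := by exact_mod_cast (by omega : 0 < n)
  have hC := zsB_pos hbn
  obtain ⟨p, hp, hpair⟩ := zsB_pair (n := n) (b := b)
  set P := Finset.powersetCard b (Finset.univ : Finset (Fin n)) with hP
  have key : ∑ I ∈ P, ‖∑ i ∈ I, u i‖ ^ 2
      = (b / n * P.card - p) * ∑ i, ‖u i‖ ^ 2 := by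
    have e1 : ∀ I : Finset (Fin n), ‖∑ i ∈ I, u i‖ ^ 2
        = ∑ i, ∑ j, if i ∈ I ∧ j ∈ I then inner ℝ (u i) (u j) else 0 := by
      intro I
      rw [← real_inner_self_eq_norm_sq, sum_inner]
      simp_rw [inner_sum, ite_and]
      simp
    simp_rw [e1]
    rw [Finset.sum_comm]
    have e2 : ∀ i, ∑ I ∈ P, ∑ j, (if i ∈ I ∧ j ∈ I then inner ℝ (u i) (u j) else 0)
        = (b / n * P.card - p) * ‖u i‖ ^ 2 := by
      intro i
      rw [Finset.sum_comm]
      have e3 : ∀ j, ∑ I ∈ P, (if i ∈ I ∧ j ∈ I then inner ℝ (u i) (u j) else 0)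
          = p * inner ℝ (u i) (u j) + if j = i then (b / n * P.card - p) * ‖u i‖ ^ 2 else 0 := by
        intro j
        rw [← Finset.sum_filter, Finset.sum_const, nsmul_eq_mul]
        by_cases hij : j = i
        · subst hij
          have := zsB_card_mem hb hbn j
          simp only [and_self, if_true, real_inner_self_eq_norm_sq]
          field_simp
          linear_combination ‖u j‖ ^ 2 * this
        · rw [hpair i j (Ne.symm hij)]
          simp [hij]
      simp_rw [e3]
      rw [Finset.sum_add_distrib, ← Finset.mul_sum, ← inner_sum, hu]
      simp
    rw [Finset.sum_congr rfl fun i _ => e2 i, ← Finset.mul_sum]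
  unfold zsB
  rw [← hP, key, div_le_iff₀ hC]
  have : 0 ≤ p * ∑ i, ‖u i‖ ^ 2 := by positivity
  nlinarith

lemma zsB_mean_var {E : Type*} [NormedAddCommGroup E] [InnerProductSpace ℝ E] {n b : ℕ}
    (hb : 1 ≤ b) (hbn : b ≤ n) (w : E) (z : Fin n → E) :
    zsB b (fun I => ‖w + ((b : ℝ)⁻¹ • ∑ i ∈ I, z i - (n : ℝ)⁻¹ • ∑ i, z i)‖ ^ 2)
      ≤ ‖w‖ ^ 2 + (b : ℝ)⁻¹ * ((n : ℝ)⁻¹ * ∑ i, ‖z i‖ ^ 2) := by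
  have hn : (0 : ℝ) < n := by exact_mod_cast (by omega : 0 < n)
  have hb0 : (0 : ℝ) < b := by exact_mod_cast (by omega : 0 < b)
  set m := (n : ℝ)⁻¹ • ∑ i, z i with hm
  have hsz : ∑ i, z i = (n : ℝ) • m := by
    rw [hm, smul_smul, mul_inv_cancel₀ hn.ne', one_smul]
  have hu : ∑ i, (z i - m) = 0 := by
    rw [Finset.sum_sub_distrib, hsz]
    simp [← Nat.cast_smul_eq_nsmul ℝ]
  have hu2 : ∑ i, ‖z i - m‖ ^ 2 ≤ ∑ i, ‖z i‖ ^ 2 := by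
    have : ∑ i, ‖z i - m‖ ^ 2 = ∑ i, ‖z i‖ ^ 2 - n * ‖m‖ ^ 2 := by
      simp_rw [norm_sub_sq_real]
      rw [Finset.sum_add_distrib, Finset.sum_sub_distrib, ← Finset.mul_sum, ← sum_inner, hsz,
        real_inner_smul_left, real_inner_self_eq_norm_sq]
      simp
      ring
    rw [this]
    have : 0 ≤ n * ‖m‖ ^ 2 := by positivity
    linarith
  have e : zsB b (fun I => ‖w + ((b : ℝ)⁻¹ • ∑ i ∈ I, z i - m)‖ ^ 2)
      = zsB b (fun I => ‖w‖ ^ 2 + (2 * (b : ℝ)⁻¹ * (∑ i ∈ I, inner ℝ w (z i - m))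
          + ((b : ℝ)⁻¹) ^ 2 * ‖∑ i ∈ I, (z i - m)‖ ^ 2)) := by
    refine zsB_congr fun I hI => ?_
    have : (b : ℝ)⁻¹ • ∑ i ∈ I, z i - m = (b : ℝ)⁻¹ • ∑ i ∈ I, (z i - m) := by
      rw [Finset.sum_sub_distrib, Finset.sum_const, hI, smul_sub, ← Nat.cast_smul_eq_nsmul ℝ,
        smul_smul, inv_mul_cancel₀ hb0.ne', one_smul]
    rw [this, norm_add_sq_real, real_inner_smul_right, inner_sum, norm_smul, mul_pow,
      Real.norm_eq_abs, sq_abs]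
    ring
  rw [e, zsB_add, zsB_add, zsB_mul, zsB_mul, zsB_const hbn, zsB_sum_mem hb hbn, ← inner_sum, hu]
  have := zsB_var hb hbn _ hu
  have h2 : ((b : ℝ)⁻¹) ^ 2 * zsB b (fun I => ‖∑ i ∈ I, (z i - m)‖ ^ 2)
      ≤ ((b : ℝ)⁻¹) ^ 2 * ((b / n : ℝ) * ∑ i, ‖z i‖ ^ 2) := by
    gcongr
    exact this.trans (by gcongr)
  have h3 : ((b : ℝ)⁻¹) ^ 2 * ((b / n : ℝ) * ∑ i, ‖z i‖ ^ 2)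
      = (b : ℝ)⁻¹ * ((n : ℝ)⁻¹ * ∑ i, ‖z i‖ ^ 2) := by field_simp
  simp only [inner_zero_right, mul_zero, zero_add]
  linarith

/-- One step of the process. -/
def zsStep {d n : ℕ} (f : Fin n → EuclideanSpace ℝ (Fin d) → ℝ) (η lam : ℝ) (b : ℕ)
    (st : EuclideanSpace ℝ (Fin d) × EuclideanSpace ℝ (Fin d) ×
      EuclideanSpace ℝ (Fin d) × (Fin n → EuclideanSpace ℝ (Fin d))) (I : Finset (Fin n)) :
    EuclideanSpace ℝ (Fin d) × EuclideanSpace ℝ (Fin d) ×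
      EuclideanSpace ℝ (Fin d) × (Fin n → EuclideanSpace ℝ (Fin d)) :=
  let v : EuclideanSpace ℝ (Fin d) :=
    (b : ℝ)⁻¹ • ∑ i ∈ I, (gradient (f i) st.1 - gradient (f i) st.2.1)
      + (1 - lam) • st.2.2.1
      + lam • ((b : ℝ)⁻¹ • ∑ i ∈ I, (gradient (f i) st.2.1 - st.2.2.2 i)
          + (n : ℝ)⁻¹ • ∑ j, st.2.2.2 j)
  (st.1 - η • v, st.1, v, fun i => if i ∈ I then gradient (f i) st.1 else st.2.2.2 i)

lemma zsState_succ {d n : ℕ} (f : Fin n → EuclideanSpace ℝ (Fin d) → ℝ)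
    (η lam : ℕ → ℝ) (b : ℕ → ℕ) (x0 : EuclideanSpace ℝ (Fin d))
    (ω : ℕ → Finset (Fin n)) (k : ℕ) :
    zsState f η lam b x0 ω (k + 1)
      = zsStep f (η k) (lam k) (b k) (zsState f η lam b x0 ω k) (ω k) := rfl

lemma zsState_update {d n : ℕ} (f : Fin n → EuclideanSpace ℝ (Fin d) → ℝ)
    (η lam : ℕ → ℝ) (b : ℕ → ℕ) (x0 : EuclideanSpace ℝ (Fin d))
    (ω : ℕ → Finset (Fin n)) (m : ℕ) (I : Finset (Fin n)) (k : ℕ) (hk : k ≤ m) :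
    zsState f η lam b x0 (Function.update ω m I) k = zsState f η lam b x0 ω k := by
  induction k with
  | zero => rfl
  | succ k ih =>
    rw [zsState_succ, zsState_succ, ih (by omega), Function.update_of_ne (by omega)]

lemma zsExpK_filter {n : ℕ} (b : ℕ → ℕ) (k : ℕ) (g : (Fin (k + 1) → Finset (Fin n)) → ℝ) :
    ∑ τ ∈ Finset.univ.filter
      (fun τ : Fin (k + 1) → Finset (Fin n) => ∀ j : Fin (k + 1), (τ j).card = b j.val), g τ
    = ∑ τ ∈ Finset.univ.filter
      (fun τ : Fin k → Finset (Fin n) => ∀ j : Fin k, (τ j).card = b j.val),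
      ∑ I ∈ Finset.powersetCard (b k) (Finset.univ : Finset (Fin n)),
        g (Fin.snoc (α := fun _ => Finset (Fin n)) τ I) := by
  rw [← Finset.sum_product']
  refine Finset.sum_bij' (fun τ _ => (fun j : Fin k => τ j.castSucc, τ (Fin.last k)))
    (fun p _ => Fin.snoc (α := fun _ => Finset (Fin n)) p.1 p.2) ?_ ?_ ?_ ?_ ?_
  · intro τ hτ
    simp only [Finset.mem_filter, Finset.mem_univ, true_and] at hτ
    simp only [Finset.mem_product, Finset.mem_filter, Finset.mem_univ, true_and,
      Finset.mem_powersetCard_univ]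
    exact ⟨fun j => by simpa using hτ j.castSucc, by simpa using hτ (Fin.last k)⟩
  · intro p hp
    simp only [Finset.mem_product, Finset.mem_filter, Finset.mem_univ, true_and,
      Finset.mem_powersetCard_univ] at hp
    simp only [Finset.mem_filter, Finset.mem_univ, true_and]
    intro j
    refine Fin.lastCases ?_ (fun i => ?_) j
    · simpa using hp.2
    · simpa using hp.1 i
  · intro τ _
    exact Fin.snoc_init_self (α := fun _ => Finset (Fin n)) τ
  · intro p _
    ext <;> simp
  · intro τ _
    congr 1
    exact (Fin.snoc_init_self (α := fun _ => Finset (Fin n)) τ).symm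

lemma zsExpK_ext {n : ℕ} (k : ℕ) (τ : Fin k → Finset (Fin n)) (I : Finset (Fin n)) :
    (fun j => if h : j < k + 1 then
      (Fin.snoc (α := fun _ => Finset (Fin n)) τ I : Fin (k + 1) → Finset (Fin n)) ⟨j, h⟩ else ∅)
    = Function.update (fun j => if h : j < k then τ ⟨j, h⟩ else ∅) k I := by
  funext j
  rcases lt_trichotomy j k with h | h | h
  · rw [Function.update_of_ne h.ne, dif_pos (by omega), dif_pos h]
    exact Fin.snoc_castSucc (α := fun _ => Finset (Fin n)) I τ ⟨j, h⟩
  · subst h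
    rw [Function.update_self, dif_pos (by omega)]
    exact Fin.snoc_last (α := fun _ => Finset (Fin n)) I τ
  · rw [Function.update_of_ne h.ne', dif_neg (by omega), dif_neg (by omega)]

lemma zsExpK_succ {n : ℕ} (b : ℕ → ℕ) (k : ℕ) (g : (ℕ → Finset (Fin n)) → ℝ) :
    zsExpK b (k + 1) g = zsExpK b k (fun ω => zsB (b k) (fun I => g (Function.update ω k I))) := by
  have hc : (((Finset.univ.filter (fun τ : Fin (k + 1) → Finset (Fin n) =>
        ∀ j : Fin (k + 1), (τ j).card = b j.val)).card : ℕ) : ℝ)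
      = ((Finset.univ.filter (fun τ : Fin k → Finset (Fin n) =>
        ∀ j : Fin k, (τ j).card = b j.val)).card : ℝ)
        * ((Finset.powersetCard (b k) (Finset.univ : Finset (Fin n))).card : ℝ) := by
    have := zsExpK_filter (n := n) b k (fun _ => 1)
    simpa using this
  unfold zsExpK zsB
  rw [hc, zsExpK_filter]
  simp_rw [zsExpK_ext]
  rw [← Finset.sum_div, div_div, mul_comm]

lemma zsExpK_zero {n : ℕ} (b : ℕ → ℕ) (g : (ℕ → Finset (Fin n)) → ℝ) :
    zsExpK b 0 g = g (fun _ => ∅) := by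
  unfold zsExpK
  simp

lemma zsExpK_mono {n : ℕ} (b : ℕ → ℕ) (k : ℕ) {g g' : (ℕ → Finset (Fin n)) → ℝ}
    (H : ∀ ω, g ω ≤ g' ω) : zsExpK b k g ≤ zsExpK b k g' := by
  unfold zsExpK
  gcongr
  exact H _

lemma zsExpK_add {n : ℕ} (b : ℕ → ℕ) (k : ℕ) (g g' : (ℕ → Finset (Fin n)) → ℝ) :
    zsExpK b k (fun ω => g ω + g' ω) = zsExpK b k g + zsExpK b k g' := by
  unfold zsExpK
  rw [Finset.sum_add_distrib, add_div]

lemma zsExpK_mul {n : ℕ} (b : ℕ → ℕ) (k : ℕ) (c : ℝ) (g : (ℕ → Finset (Fin n)) → ℝ) :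
    zsExpK b k (fun ω => c * g ω) = c * zsExpK b k g := by
  unfold zsExpK
  rw [← Finset.mul_sum, mul_div_assoc]

lemma zsExpK_const {n : ℕ} (b : ℕ → ℕ) (hb : ∀ k, b k ≤ n) (k : ℕ) (c : ℝ) :
    zsExpK b k (fun _ : ℕ → Finset (Fin n) => c) = c := by
  induction k with
  | zero => rw [zsExpK_zero]
  | succ k ih =>
    rw [zsExpK_succ]
    simp_rw [zsB_const (hb k)]
    exact ih

lemma zsExpK_state_succ {d n : ℕ} (f : Fin n → EuclideanSpace ℝ (Fin d) → ℝ)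
    (η lam : ℕ → ℝ) (b : ℕ → ℕ) (x0 : EuclideanSpace ℝ (Fin d)) (k : ℕ)
    (φ : EuclideanSpace ℝ (Fin d) × EuclideanSpace ℝ (Fin d) ×
      EuclideanSpace ℝ (Fin d) × (Fin n → EuclideanSpace ℝ (Fin d)) → ℝ) :
    zsExpK b (k + 1) (fun ω => φ (zsState f η lam b x0 ω (k + 1)))
      = zsExpK b k (fun ω => zsB (b k) (fun I =>
          φ (zsStep f (η k) (lam k) (b k) (zsState f η lam b x0 ω k) I))) := by
  rw [zsExpK_succ]
  simp_rw [zsState_succ, zsState_update f η lam b x0 _ k _ k le_rfl, Function.update_self]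

lemma zs_hasGradientAt_avgF {d n : ℕ} (f : Fin n → EuclideanSpace ℝ (Fin d) → ℝ)
    (hdiff : ∀ i, Differentiable ℝ (f i)) (x : EuclideanSpace ℝ (Fin d)) :
    HasGradientAt (avgF f) ((n : ℝ)⁻¹ • ∑ i, gradient (f i) x) x := by
  rw [hasGradientAt_iff_hasFDerivAt]
  have h : HasFDerivAt (fun z => ∑ i, f i z)
      (∑ i, (InnerProductSpace.toDual ℝ (EuclideanSpace ℝ (Fin d))) (gradient (f i) x)) x := by
    refine HasFDerivAt.fun_sum fun i _ => ?_
    exact ((hdiff i) x).hasGradientAt.hasFDerivAt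
  have h2 := h.const_mul (n : ℝ)⁻¹
  unfold avgF
  rw [map_smul, map_sum]
  exact h2

lemma zs_descent {E : Type*} [NormedAddCommGroup E] [InnerProductSpace ℝ E] [CompleteSpace E]
    (F : E → ℝ) (G : E → E) (hG : ∀ x, HasGradientAt F (G x) x) (L : ℝ)
    (hL : ∀ x y, ‖G x - G y‖ ≤ L * ‖x - y‖) (x h : E) :
    F (x + h) ≤ F x + inner ℝ (G x) h + L / 2 * ‖h‖ ^ 2 := by
  let ψ : ℝ → ℝ := fun t => F (x + t • h) - t * inner ℝ (G x) h - L / 2 * ‖h‖ ^ 2 * t ^ 2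
  have hd : ∀ t, HasDerivAt ψ
      (inner ℝ (G (x + t • h)) h - inner ℝ (G x) h - L * ‖h‖ ^ 2 * t) t := by
    intro t
    have h1 : HasDerivAt (fun t : ℝ => x + t • h) h t := by
      simpa using ((hasDerivAt_id t).smul_const h).const_add x
    have h2 : HasDerivAt (fun t : ℝ => F (x + t • h)) (inner ℝ (G (x + t • h)) h) t := by
      have := (hG (x + t • h)).hasFDerivAt.comp_hasDerivAt t h1
      rw [InnerProductSpace.toDual_apply_apply] at this
      exact this
    have h3 : HasDerivAt (fun t : ℝ => t * inner ℝ (G x) h) (inner ℝ (G x) h) t := by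
      simpa using (hasDerivAt_id t).mul_const (inner ℝ (G x) h)
    have h4 : HasDerivAt (fun t : ℝ => L / 2 * ‖h‖ ^ 2 * t ^ 2) (L * ‖h‖ ^ 2 * t) t := by
      have := (hasDerivAt_pow 2 t).const_mul (L / 2 * ‖h‖ ^ 2)
      refine this.congr_deriv ?_
      norm_num
      ring
    exact (h2.sub h3).sub h4
  have hanti : AntitoneOn ψ (Set.Icc 0 1) := by
    refine antitoneOn_of_deriv_nonpos (convex_Icc 0 1)
      (fun t _ => (hd t).continuousAt.continuousWithinAt)
      (fun t _ => (hd t).differentiableAt.differentiableWithinAt) (fun t ht => ?_)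
    rw [interior_Icc] at ht
    rw [(hd t).deriv, ← inner_sub_left]
    have h1 := real_inner_le_norm (G (x + t • h) - G x) h
    have h2 := hL (x + t • h) x
    rw [add_sub_cancel_left, norm_smul, Real.norm_eq_abs, abs_of_pos ht.1] at h2
    have h3 := mul_le_mul_of_nonneg_right h2 (norm_nonneg h)
    nlinarith
  have := hanti (by simp : (0 : ℝ) ∈ Set.Icc (0 : ℝ) 1) (by simp : (1 : ℝ) ∈ Set.Icc (0 : ℝ) 1)
    zero_le_one
  simp only [ψ, one_smul, zero_smul, add_zero] at this
  linarith

lemma zs_descent_step {E : Type*} [NormedAddCommGroup E] [InnerProductSpace ℝ E] [CompleteSpace E]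
    (F : E → ℝ) (G : E → E) (hG : ∀ x, HasGradientAt F (G x) x) (L : ℝ)
    (hL : ∀ x y, ‖G x - G y‖ ≤ L * ‖x - y‖) (x v : E) (η : ℝ) (hη : 0 < η) :
    F (x - η • v) ≤ F x - η / 2 * ‖G x‖ ^ 2 - (1 / (2 * η) - L / 2) * ‖(x - η • v) - x‖ ^ 2
      + η / 2 * ‖v - G x‖ ^ 2 := by
  have h := zs_descent F G hG L hL x (-(η • v))
  rw [← sub_eq_add_neg] at h
  have e : x - η • v - x = -(η • v) := by abel
  rw [e, norm_sub_sq_real]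
  rw [inner_neg_right, real_inner_smul_right] at h
  rw [real_inner_comm (G x) v]
  rw [norm_neg, norm_smul, Real.norm_eq_abs, mul_pow, sq_abs] at h ⊢
  have : (1 / (2 * η) - L / 2) * (η ^ 2 * ‖v‖ ^ 2)
     = η / 2 * ‖v‖ ^ 2 - L / 2 * (η ^ 2 * ‖v‖ ^ 2) := by field_simp
  rw [this]
  linarith

/-- The averaged gradient. -/
def zsGbar {d n : ℕ} (f : Fin n → EuclideanSpace ℝ (Fin d) → ℝ) (x : EuclideanSpace ℝ (Fin d)) :
    EuclideanSpace ℝ (Fin d) := (n : ℝ)⁻¹ • ∑ i, gradient (f i) x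

/-- Squared estimator error. -/
def zsG {d n : ℕ} (f : Fin n → EuclideanSpace ℝ (Fin d) → ℝ)
    (st : EuclideanSpace ℝ (Fin d) × EuclideanSpace ℝ (Fin d) ×
      EuclideanSpace ℝ (Fin d) × (Fin n → EuclideanSpace ℝ (Fin d))) : ℝ :=
  ‖st.2.2.1 - zsGbar f st.2.1‖ ^ 2

/-- Mean squared table error. -/
def zsD {d n : ℕ} (f : Fin n → EuclideanSpace ℝ (Fin d) → ℝ)
    (st : EuclideanSpace ℝ (Fin d) × EuclideanSpace ℝ (Fin d) ×
      EuclideanSpace ℝ (Fin d) × (Fin n → EuclideanSpace ℝ (Fin d))) : ℝ :=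
  (n : ℝ)⁻¹ * ∑ i, ‖gradient (f i) st.2.1 - st.2.2.2 i‖ ^ 2

/-- Squared displacement. -/
def zsS {d n : ℕ}
    (st : EuclideanSpace ℝ (Fin d) × EuclideanSpace ℝ (Fin d) ×
      EuclideanSpace ℝ (Fin d) × (Fin n → EuclideanSpace ℝ (Fin d))) : ℝ :=
  ‖st.1 - st.2.1‖ ^ 2

lemma zsG_step {d n : ℕ} (f : Fin n → EuclideanSpace ℝ (Fin d) → ℝ) (L : ℝ)
    (hsmooth : ∀ i (x y : EuclideanSpace ℝ (Fin d)),
      ‖gradient (f i) x - gradient (f i) y‖ ≤ L * ‖x - y‖)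
    (η lam : ℝ) (b : ℕ) (hb : 1 ≤ b) (hbn : b ≤ n)
    (st : EuclideanSpace ℝ (Fin d) × EuclideanSpace ℝ (Fin d) ×
      EuclideanSpace ℝ (Fin d) × (Fin n → EuclideanSpace ℝ (Fin d))) :
    zsB b (fun I => zsG f (zsStep f η lam b st I))
      ≤ (1 - lam) ^ 2 * zsG f st + (b : ℝ)⁻¹ * (2 * L ^ 2 * zsS st + 2 * lam ^ 2 * zsD f st) := by
  obtain ⟨x, xp, v, y⟩ := st
  have hn : (0 : ℝ) < n := by exact_mod_cast (by omega : 0 < n)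
  let A : Fin n → EuclideanSpace ℝ (Fin d) := fun i => gradient (f i) x - gradient (f i) xp
  let B : Fin n → EuclideanSpace ℝ (Fin d) := fun i => gradient (f i) xp - y i
  have h := zsB_mean_var hb hbn ((1 - lam) • (v - zsGbar f xp)) (fun i => A i + lam • B i)
  have e : zsB b (fun I => zsG f (zsStep f η lam b (x, xp, v, y) I))
     = zsB b (fun I => ‖(1 - lam) • (v - zsGbar f xp) + ((b : ℝ)⁻¹ • ∑ i ∈ I, (A i + lam • B i)
        - (n : ℝ)⁻¹ • ∑ i, (A i + lam • B i))‖ ^ 2) := by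
    refine zsB_congr fun I hI => ?_
    unfold zsG zsStep zsGbar
    congr 2
    simp only [A, B, Finset.sum_add_distrib, Finset.sum_sub_distrib, ← Finset.smul_sum]
    module
  rw [e]
  refine h.trans ?_
  have h1 : ‖(1 - lam) • (v - zsGbar f xp)‖ ^ 2 = (1 - lam) ^ 2 * zsG f (x, xp, v, y) := by
    rw [norm_smul, mul_pow, Real.norm_eq_abs, sq_abs]; rfl
  have h2 : (n : ℝ)⁻¹ * ∑ i, ‖A i + lam • B i‖ ^ 2
      ≤ 2 * L ^ 2 * zsS (x, xp, v, y) + 2 * lam ^ 2 * zsD f (x, xp, v, y) := by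
    have h3 : ∀ i, ‖A i + lam • B i‖ ^ 2 ≤ 2 * L ^ 2 * ‖x - xp‖ ^ 2 + 2 * lam ^ 2 * ‖B i‖ ^ 2 := by
      intro i
      have a1 : ‖A i‖ ^ 2 ≤ (L * ‖x - xp‖) ^ 2 :=
        pow_le_pow_left₀ (norm_nonneg _) (hsmooth i x xp) 2
      have a2 := parallelogram_law_with_norm ℝ (A i) (lam • B i)
      have a3 : ‖lam • B i‖ ^ 2 = lam ^ 2 * ‖B i‖ ^ 2 := by
        rw [norm_smul, mul_pow, Real.norm_eq_abs, sq_abs]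
      nlinarith [mul_self_nonneg ‖A i - lam • B i‖]
    calc (n : ℝ)⁻¹ * ∑ i, ‖A i + lam • B i‖ ^ 2
        ≤ (n : ℝ)⁻¹ * ∑ i, (2 * L ^ 2 * ‖x - xp‖ ^ 2 + 2 * lam ^ 2 * ‖B i‖ ^ 2) := by
          gcongr with i _
          exact h3 i
      _ = _ := by
          rw [Finset.sum_add_distrib, ← Finset.mul_sum Finset.univ (fun i => ‖B i‖ ^ 2)]
          simp only [Finset.sum_const, Finset.card_univ, Fintype.card_fin, nsmul_eq_mul, zsS, zsD,
            B]
          field_simp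
  rw [h1]
  gcongr

lemma zsD_step {d n r : ℕ} (f : Fin n → EuclideanSpace ℝ (Fin d) → ℝ) (L : ℝ)
    (hsmooth : ∀ i (x y : EuclideanSpace ℝ (Fin d)),
      ‖gradient (f i) x - gradient (f i) y‖ ≤ L * ‖x - y‖)
    (η lam : ℝ) (hr1 : 1 ≤ r) (hr : n = r ^ 2)
    (st : EuclideanSpace ℝ (Fin d) × EuclideanSpace ℝ (Fin d) ×
      EuclideanSpace ℝ (Fin d) × (Fin n → EuclideanSpace ℝ (Fin d))) :
    zsB r (fun I => zsD f (zsStep f η lam r st I))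
      ≤ (1 - 1 / (2 * (r : ℝ))) * zsD f st + 2 * r * L ^ 2 * zsS st := by
  obtain ⟨x, xp, v, y⟩ := st
  have hrn : r ≤ n := by rw [hr]; nlinarith
  have hr0 : (1 : ℝ) ≤ r := by exact_mod_cast hr1
  have hnr : (n : ℝ) = (r : ℝ) ^ 2 := by rw [hr]; push_cast; rfl
  let a : Fin n → ℝ := fun j => ‖gradient (f j) x - y j‖ ^ 2
  have e : zsB r (fun I => zsD f (zsStep f η lam r (x, xp, v, y) I))
      = zsB r (fun I => (n : ℝ)⁻¹ * ∑ j, a j + (-(n : ℝ)⁻¹) * ∑ j ∈ I, a j) := by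
    refine zsB_congr fun I hI => ?_
    have e1 : ∑ j ∈ I, a j = ∑ j, if j ∈ I then a j else 0 := by simp
    rw [e1, neg_mul, ← sub_eq_add_neg, ← mul_sub, ← Finset.sum_sub_distrib]
    unfold zsD zsStep
    congr 1
    refine Finset.sum_congr rfl fun j _ => ?_
    by_cases hj : j ∈ I <;> simp [hj, a]
  rw [e, zsB_add, zsB_const hrn, zsB_mul, zsB_sum_mem hr1 hrn]
  set T := (n : ℝ)⁻¹ * ∑ j, a j with hT
  have e2 : T + -(n : ℝ)⁻¹ * ((r / n : ℝ) * ∑ j, a j) = (1 - 1 / (r : ℝ)) * T := by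
    rw [hT, hnr]; field_simp; ring
  rw [e2]
  have hTle : T ≤ (1 + 1 / (2 * (r : ℝ))) * zsD f (x, xp, v, y)
      + (1 + 2 * r) * L ^ 2 * zsS (x, xp, v, y) := by
    have h3 : ∀ j, a j ≤ (1 + 1 / (2 * (r : ℝ))) * ‖gradient (f j) xp - y j‖ ^ 2
        + (1 + 2 * r) * L ^ 2 * ‖x - xp‖ ^ 2 := by
      intro j
      have a1 : ‖gradient (f j) x - gradient (f j) xp‖ ^ 2 ≤ (L * ‖x - xp‖) ^ 2 :=
        pow_le_pow_left₀ (norm_nonneg _) (hsmooth j x xp) 2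
      have a2 : ‖gradient (f j) x - y j‖
          ≤ ‖gradient (f j) x - gradient (f j) xp‖ + ‖gradient (f j) xp - y j‖ :=
        norm_sub_le_norm_sub_add_norm_sub _ _ _
      have a3 := pow_le_pow_left₀ (norm_nonneg _) a2 2
      set p := ‖gradient (f j) x - gradient (f j) xp‖
      set q := ‖gradient (f j) xp - y j‖
      have a4 : (p + q) ^ 2 ≤ (1 + 1 / (2 * (r : ℝ))) * q ^ 2 + (1 + 2 * r) * p ^ 2 := by
        have : (1 + 1 / (2 * (r : ℝ))) * q ^ 2 + (1 + 2 * r) * p ^ 2 - (p + q) ^ 2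
            = (q - 2 * r * p) ^ 2 / (2 * r) := by
          field_simp
          ring
        have h0 : 0 ≤ (q - 2 * r * p) ^ 2 / (2 * (r : ℝ)) := by positivity
        linarith
      have a5 : (1 + 2 * (r : ℝ)) * p ^ 2 ≤ (1 + 2 * r) * (L * ‖x - xp‖) ^ 2 := by gcongr
      have a6 : a j = ‖gradient (f j) x - y j‖ ^ 2 := rfl
      rw [a6]
      linarith
    calc T ≤ (n : ℝ)⁻¹ * ∑ j, ((1 + 1 / (2 * (r : ℝ))) * ‖gradient (f j) xp - y j‖ ^ 2
        + (1 + 2 * r) * L ^ 2 * ‖x - xp‖ ^ 2) := by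
          rw [hT]
          gcongr with j _
          exact h3 j
      _ = _ := by
          rw [Finset.sum_add_distrib, ← Finset.mul_sum]
          simp only [Finset.sum_const, Finset.card_univ, Fintype.card_fin, nsmul_eq_mul, zsS, zsD]
          have : (n : ℝ) ≠ 0 := by rw [hnr]; positivity
          field_simp
  have hD : 0 ≤ zsD f (x, xp, v, y) := by unfold zsD; positivity
  have hS : 0 ≤ L ^ 2 * zsS (x, xp, v, y) := by unfold zsS; positivity
  have hc : 0 ≤ 1 - 1 / (r : ℝ) := by
    rw [sub_nonneg, div_le_one (by linarith)]; exact hr0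
  have h4 := mul_le_mul_of_nonneg_left hTle hc
  have c1 : (1 - 1 / (r : ℝ)) * (1 + 1 / (2 * (r : ℝ))) ≤ 1 - 1 / (2 * (r : ℝ)) := by
    have : 1 - 1 / (2 * (r : ℝ)) - (1 - 1 / (r : ℝ)) * (1 + 1 / (2 * (r : ℝ)))
        = 1 / (2 * (r : ℝ) ^ 2) := by field_simp; ring
    have h0 : 0 ≤ 1 / (2 * (r : ℝ) ^ 2) := by positivity
    linarith
  have c2 : (1 - 1 / (r : ℝ)) * (1 + 2 * r) ≤ 2 * r := by
    have : 2 * r - (1 - 1 / (r : ℝ)) * (1 + 2 * r) = 1 + 1 / r := by field_simp; ring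
    have h0 : 0 ≤ 1 / (r : ℝ) := by positivity
    linarith
  have c3 := mul_le_mul_of_nonneg_right c1 hD
  have c4 := mul_le_mul_of_nonneg_right c2 hS
  linarith

lemma zs_main {d n r : ℕ} (hn : 2 ≤ n)
    (hr : n = r ^ 2)
    (L : ℝ) (hL : 0 < L)
    (f : Fin n → EuclideanSpace ℝ (Fin d) → ℝ)
    (hdiff : ∀ i, Differentiable ℝ (f i))
    (hsmooth : ∀ i (x y : EuclideanSpace ℝ (Fin d)),
      ‖gradient (f i) x - gradient (f i) y‖ ≤ L * ‖x - y‖)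
    (x0 : EuclideanSpace ℝ (Fin d))
    (fstar : ℝ) (hfstar : IsGLB (Set.range (avgF f)) fstar)
    (η lam : ℕ → ℝ) (b : ℕ → ℕ)
    (hη : ∀ k, η k = 1 / ((1 + Real.sqrt 8) * L))
    (hb0 : b 0 = n) (hbk : ∀ k, 1 ≤ k → b k = r)
    (hlam0 : lam 0 = 1) (hlamk : ∀ k, 1 ≤ k → lam k = 1 / (2 * (r : ℝ)))
    (K : ℕ) (hK : 1 ≤ K) :
    ∑ k ∈ Finset.range K,
        zsExpK b k (fun ω => ‖gradient (avgF f) ((zsState f η lam b x0 ω k).1)‖ ^ 2)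
      ≤ 2 * (1 + Real.sqrt 8) * L * (avgF f x0 - fstar) := by
  have hr1 : 1 ≤ r := by
    rcases Nat.eq_zero_or_pos r with h | h
    · subst h; omega
    · exact h
  have hrn : r ≤ n := by rw [hr]; nlinarith
  have hr0 : (1 : ℝ) ≤ r := by exact_mod_cast hr1
  have hbn : ∀ k, b k ≤ n := by
    intro k
    rcases Nat.eq_zero_or_pos k with h | h
    · rw [h, hb0]
    · rw [hbk k h]; exact hrn
  have hn0 : (0 : ℝ) < n := by exact_mod_cast (by omega : 0 < n)
  set e : ℝ := 1 / ((1 + Real.sqrt 8) * L) with he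
  have h8 : Real.sqrt 8 ^ 2 = 8 := Real.sq_sqrt (by norm_num)
  have h8p : 0 < Real.sqrt 8 := Real.sqrt_pos.2 (by norm_num)
  have hepos : 0 < e := by positivity
  set c : ℝ := 1 / (2 * e) - L / 2 with hc
  have hc4 : 4 * e * L ^ 2 ≤ c := by
    have h1 : c = Real.sqrt 8 * L / 2 := by
      rw [hc, he]; field_simp; ring
    have h2 : c - 4 * e * L ^ 2 = L * Real.sqrt 8 / (2 * (1 + Real.sqrt 8)) := by
      rw [h1, he]; field_simp; nlinarith
    have h3 : 0 ≤ L * Real.sqrt 8 / (2 * (1 + Real.sqrt 8)) := by positivity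
    linarith
  have hgrad : ∀ x, HasGradientAt (avgF f) (zsGbar f x) x := zs_hasGradientAt_avgF f hdiff
  have hgbar : ∀ x, gradient (avgF f) x = zsGbar f x := fun x => (hgrad x).gradient
  have hlip : ∀ x y, ‖zsGbar f x - zsGbar f y‖ ≤ L * ‖x - y‖ := by
    intro x y
    unfold zsGbar
    rw [← smul_sub, ← Finset.sum_sub_distrib, norm_smul, norm_inv, Real.norm_natCast]
    calc (n : ℝ)⁻¹ * ‖∑ i, (gradient (f i) x - gradient (f i) y)‖
        ≤ (n : ℝ)⁻¹ * ∑ _i : Fin n, L * ‖x - y‖ := by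
          gcongr
          exact (norm_sum_le _ _).trans (Finset.sum_le_sum fun i _ => hsmooth i x y)
      _ = L * ‖x - y‖ := by
          simp only [Finset.sum_const, Finset.card_univ, Fintype.card_fin, nsmul_eq_mul]
          field_simp
  -- expectations of functionals of the state
  obtain ⟨Ek, hEk⟩ : ∃ Ek : ℕ → (EuclideanSpace ℝ (Fin d) × EuclideanSpace ℝ (Fin d) ×
      EuclideanSpace ℝ (Fin d) × (Fin n → EuclideanSpace ℝ (Fin d)) → ℝ) → ℝ,
    ∀ k φ, Ek k φ = zsExpK b k (fun ω => φ (zsState f η lam b x0 ω k)) := ⟨_, fun _ _ => rfl⟩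
  have Esucc : ∀ k φ, Ek (k + 1) φ = Ek k (fun st => zsB (b k) (fun I =>
      φ (zsStep f (η k) (lam k) (b k) st I))) := fun k φ => by
    rw [hEk, hEk]; exact zsExpK_state_succ f η lam b x0 k φ
  have Eadd : ∀ k φ ψ, Ek k (fun st => φ st + ψ st) = Ek k φ + Ek k ψ :=
    fun k φ ψ => by rw [hEk, hEk, hEk]; exact zsExpK_add b k _ _
  have Emul : ∀ k (a : ℝ) φ, Ek k (fun st => a * φ st) = a * Ek k φ :=
    fun k a φ => by rw [hEk, hEk]; exact zsExpK_mul b k a _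
  have Emono : ∀ k φ ψ, (∀ st, φ st ≤ ψ st) → Ek k φ ≤ Ek k ψ :=
    fun k φ ψ h => by rw [hEk, hEk]; exact zsExpK_mono b k fun ω => h _
  have Econst : ∀ k (a : ℝ), Ek k (fun _ => a) = a := fun k a => by
    rw [hEk]; exact zsExpK_const b hbn k a
  let F : ℕ → ℝ := fun k => Ek k (fun st => avgF f st.1)
  let N : ℕ → ℝ := fun k => Ek k (fun st => ‖zsGbar f st.1‖ ^ 2)
  let G : ℕ → ℝ := fun k => Ek k (zsG f)
  let D : ℕ → ℝ := fun k => Ek k (zsD f)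
  let S : ℕ → ℝ := fun k => Ek k zsS
  have hdesc : ∀ k, F (k + 1) ≤ F k - e / 2 * N k - c * S (k + 1) + e / 2 * G (k + 1) := by
    intro k
    have h1 : F (k + 1) + (c * S (k + 1) + (-(e / 2)) * G (k + 1))
        ≤ F k + (-(e / 2)) * N k := by
      simp only [F, N, G, S]
      rw [← Emul, ← Emul, ← Emul, ← Eadd, ← Eadd, ← Eadd, Esucc]
      refine Emono _ _ _ fun st => ?_
      rw [← zsB_const (hbn k) (avgF f st.1 + -(e / 2) * ‖zsGbar f st.1‖ ^ 2)]
      refine zsB_mono fun I _ => ?_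
      have := zs_descent_step (avgF f) (zsGbar f) hgrad L hlip st.1
        (zsStep f (η k) (lam k) (b k) st I).2.2.1 e hepos
      rw [← hc] at this
      rw [hη k] at this ⊢
      simp only [zsG, zsS, zsStep] at this ⊢
      linarith
    linarith
  have hG : ∀ k, 1 ≤ k → G (k + 1) ≤ (1 - 1 / (2 * (r : ℝ))) ^ 2 * G k
      + (2 * L ^ 2 / r * S k + 1 / (2 * (r : ℝ) ^ 3) * D k) := by
    intro k hk
    simp only [G, S, D]
    rw [← Emul, ← Emul, ← Emul, ← Eadd, ← Eadd, Esucc]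
    refine Emono _ _ _ fun st => ?_
    rw [hbk k hk]
    refine (zsG_step f L hsmooth (η k) (lam k) r hr1 hrn st).trans (le_of_eq ?_)
    rw [hlamk k hk]
    field_simp
  have hD : ∀ k, 1 ≤ k → D (k + 1) ≤ (1 - 1 / (2 * (r : ℝ))) * D k + 2 * r * L ^ 2 * S k := by
    intro k hk
    simp only [S, D]
    rw [← Emul, ← Emul, ← Eadd, Esucc]
    refine Emono _ _ _ fun st => ?_
    rw [hbk k hk]
    exact zsD_step f L hsmooth (η k) (lam k) hr1 hr st
  have hGnn : ∀ k, 0 ≤ G k := by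
    intro k
    rw [← Econst k 0]
    refine Emono k (fun _ => 0) (zsG f) fun st => ?_
    unfold zsG; positivity
  have hDnn : ∀ k, 0 ≤ D k := by
    intro k
    rw [← Econst k 0]
    refine Emono k (fun _ => 0) (zsD f) fun st => ?_
    unfold zsD; positivity
  have hSnn : ∀ k, 0 ≤ S k := by
    intro k
    rw [← Econst k 0]
    refine Emono k (fun _ => 0) (zsS) fun st => ?_
    unfold zsS; positivity
  have hfull : ∀ φ, Ek 1 φ = φ (zsStep f (η 0) 1 n (x0, x0, 0, fun _ => 0) Finset.univ) := by
    intro φ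
    rw [Esucc 0 φ]
    rw [hEk, zsExpK_zero, hb0, hlam0]
    rw [← zsB_const (le_refl n) (φ (zsStep f (η 0) 1 n (x0, x0, 0, fun _ => 0) Finset.univ))]
    refine zsB_congr fun I hI => ?_
    have : I = Finset.univ := Finset.eq_univ_of_card I (by simpa using hI)
    rw [this]
    rfl
  have hG1 : G 1 = 0 := by
    simp only [G]
    rw [hfull]
    simp [zsG, zsStep, zsGbar]
  have hD1 : D 1 = 0 := by
    simp only [D]
    rw [hfull]
    simp [zsD, zsStep]
  have hF0 : F 0 = avgF f x0 := by
    simp only [F]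
    rw [hEk, zsExpK_zero]
    rfl
  have hFlow : ∀ k, fstar ≤ F k := by
    intro k
    rw [← Econst k fstar]
    exact Emono _ _ _ fun st => hfstar.1 ⟨_, rfl⟩
  have hlyap : ∀ k, F (k + 1) + c * S (k + 1) + (e * r - e / 2) * G (k + 1) + e / r * D (k + 1)
      + e / 2 * ∑ j ∈ Finset.range (k + 1), N j ≤ F 0 := by
    intro k
    induction k with
    | zero =>
      have := hdesc 0
      simp only [zero_add, Finset.sum_range_one] at this ⊢
      rw [hG1, hD1] at *
      linarith
    | succ k ih =>
      rw [Finset.sum_range_succ]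
      have h1 := hdesc (k + 1)
      have h2 := mul_le_mul_of_nonneg_left (hG (k + 1) (by omega)) (by positivity : 0 ≤ e * r)
      have h3 := mul_le_mul_of_nonneg_left (hD (k + 1) (by omega)) (by positivity : 0 ≤ e / r)
      have hg := hGnn (k + 1)
      have hs := mul_le_mul_of_nonneg_right hc4 (hSnn (k + 1))
      have e2 : e * r * ((1 - 1 / (2 * (r : ℝ))) ^ 2 * G (k + 1)
          + (2 * L ^ 2 / r * S (k + 1) + 1 / (2 * (r : ℝ) ^ 3) * D (k + 1)))
          = (e * r - e / 2) * G (k + 1) - e / 2 * (1 - 1 / (2 * (r : ℝ))) * G (k + 1)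
            + 2 * e * L ^ 2 * S (k + 1) + e / (2 * (r : ℝ) ^ 2) * D (k + 1) := by
        field_simp
        ring
      have e3 : e / r * ((1 - 1 / (2 * (r : ℝ))) * D (k + 1) + 2 * r * L ^ 2 * S (k + 1))
          = e / r * D (k + 1) - e / (2 * (r : ℝ) ^ 2) * D (k + 1) + 2 * e * L ^ 2 * S (k + 1) := by
        field_simp
      have h4 : 0 ≤ e / 2 * (1 - 1 / (2 * (r : ℝ))) * G (k + 1) := by
        have : 0 ≤ 1 - 1 / (2 * (r : ℝ)) := by
          rw [sub_nonneg, div_le_one (by linarith)]; linarith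
        positivity
      rw [e2] at h2
      rw [e3] at h3
      linarith
  obtain ⟨k, rfl⟩ : ∃ k, K = k + 1 := ⟨K - 1, by omega⟩
  have h1 := hlyap k
  have h2 : 0 ≤ (e * r - e / 2) * G (k + 1) := by
    have : 0 ≤ e * r - e / 2 := by nlinarith
    exact mul_nonneg this (hGnn _)
  have h3 : 0 ≤ e / r * D (k + 1) := mul_nonneg (by positivity) (hDnn _)
  have h4 : 0 ≤ c * S (k + 1) := mul_nonneg (le_trans (by positivity) hc4) (hSnn _)
  have h5 := hFlow (k + 1)
  have h6 : e / 2 * ∑ j ∈ Finset.range (k + 1), N j ≤ avgF f x0 - fstar := by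
    rw [← hF0]; linarith
  simp_rw [hgbar]
  have hN : ∀ j, zsExpK b j (fun ω => ‖zsGbar f ((zsState f η lam b x0 ω j).1)‖ ^ 2) = N j :=
    fun j => (hEk j (fun st => ‖zsGbar f st.1‖ ^ 2)).symm
  simp_rw [hN]
  have h7 : 2 * (1 + Real.sqrt 8) * L * (e / 2) = 1 := by rw [he]; field_simp
  calc ∑ j ∈ Finset.range (k + 1), N j
      = 2 * (1 + Real.sqrt 8) * L * (e / 2 * ∑ j ∈ Finset.range (k + 1), N j) := by
        rw [← mul_assoc, h7, one_mul]
    _ ≤ _ := by gcongr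

/-- Corollary 1 (ZeroSARAH with one initial full gradient: `b₀ = n`, `bₖ = √n`,
`λ₀ = 1`, `λₖ = 1/(2√n)`, constant stepsize `η = 1/((1+√8)L)`). -/
theorem zerosarah_corollary1 {d n r : ℕ} (hd : 1 ≤ d) (hn : 2 ≤ n)
    (hr : n = r ^ 2)
    (L : ℝ) (hL : 0 < L)
    (f : Fin n → EuclideanSpace ℝ (Fin d) → ℝ)
    (hdiff : ∀ i, Differentiable ℝ (f i))
    (hsmooth : ∀ i (x y : EuclideanSpace ℝ (Fin d)),
      ‖gradient (f i) x - gradient (f i) y‖ ≤ L * ‖x - y‖)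
    (x0 : EuclideanSpace ℝ (Fin d))
    (fstar : ℝ) (hfstar : IsGLB (Set.range (avgF f)) fstar)
    (η lam : ℕ → ℝ) (b : ℕ → ℕ)
    (hη : ∀ k, η k = 1 / ((1 + Real.sqrt 8) * L))
    (hb0 : b 0 = n) (hbk : ∀ k, 1 ≤ k → b k = r)
    (hlam0 : lam 0 = 1) (hlamk : ∀ k, 1 ≤ k → lam k = 1 / (2 * (r : ℝ))) :
    (∀ K : ℕ, 1 ≤ K →
      (K : ℝ)⁻¹ * ∑ k ∈ Finset.range K,
          zsExpK b k (fun ω => ‖gradient (avgF f) ((zsState f η lam b x0 ω k).1)‖ ^ 2)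
        ≤ 2 * (1 + Real.sqrt 8) * L * (avgF f x0 - fstar) / (K : ℝ))
    ∧ (∀ ε : ℝ, 0 < ε → ∀ K : ℕ,
        K = ⌈2 * (1 + Real.sqrt 8) * L * (avgF f x0 - fstar) / ε ^ 2⌉₊ →
        (K : ℝ)⁻¹ * ∑ k ∈ Finset.range K,
            zsExpK b k (fun ω => ‖gradient (avgF f) ((zsState f η lam b x0 ω k).1)‖ ^ 2)
          ≤ ε ^ 2
        ∧ ∑ k ∈ Finset.range K, (b k : ℝ)
          ≤ (n : ℝ) + 2 * (1 + Real.sqrt 8) * (r : ℝ) * L * (avgF f x0 - fstar) / ε ^ 2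
            + (r : ℝ)) := by
  have main := zs_main hn hr L hL f hdiff hsmooth x0 fstar hfstar η lam b hη hb0 hbk hlam0 hlamk
  have part1 : ∀ K : ℕ, 1 ≤ K →
      (K : ℝ)⁻¹ * ∑ k ∈ Finset.range K,
          zsExpK b k (fun ω => ‖gradient (avgF f) ((zsState f η lam b x0 ω k).1)‖ ^ 2)
        ≤ 2 * (1 + Real.sqrt 8) * L * (avgF f x0 - fstar) / (K : ℝ) := by
    intro K hK
    rw [div_eq_inv_mul]
    exact mul_le_mul_of_nonneg_left (main K hK) (by positivity)
  refine ⟨part1, ?_⟩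
  intro ε hε K hK
  have hΔ : 0 ≤ avgF f x0 - fstar := sub_nonneg.2 (hfstar.1 ⟨x0, rfl⟩)
  have hX : 0 ≤ 2 * (1 + Real.sqrt 8) * L * (avgF f x0 - fstar) / ε ^ 2 := by positivity
  have hX2 : 2 * (1 + Real.sqrt 8) * (r : ℝ) * L * (avgF f x0 - fstar) / ε ^ 2
      = r * (2 * (1 + Real.sqrt 8) * L * (avgF f x0 - fstar) / ε ^ 2) := by ring
  rw [hX2]
  have hle := Nat.le_ceil (2 * (1 + Real.sqrt 8) * L * (avgF f x0 - fstar) / ε ^ 2)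
  have hlt := Nat.ceil_lt_add_one hX
  rw [← hK] at hle hlt
  rcases Nat.eq_zero_or_pos K with h0 | h0
  · subst h0
    simp only [Finset.range_zero, Finset.sum_empty, mul_zero]
    constructor <;> positivity
  · constructor
    · refine (part1 K h0).trans ?_
      have hK0 : (0 : ℝ) < K := by exact_mod_cast h0
      rw [div_le_iff₀ (by positivity)] at hle
      rw [div_le_iff₀ hK0]
      linarith
    · obtain ⟨m, rfl⟩ : ∃ m, K = m + 1 := ⟨K - 1, by omega⟩
      rw [Finset.sum_range_succ', hb0]
      have : ∑ k ∈ Finset.range m, (b (k + 1) : ℝ) = m * r := by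
        rw [Finset.sum_congr rfl fun k _ => by rw [hbk (k + 1) (by omega)]]
        simp
      rw [this]
      push_cast at hlt
      have hm : (m : ℝ) * r ≤ (2 * (1 + Real.sqrt 8) * L * (avgF f x0 - fstar) / ε ^ 2) * r :=
        mul_le_mul_of_nonneg_right (by linarith) (by positivity)
      have : (0 : ℝ) ≤ r := by positivity
      linarith
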